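/- Let T be an n-tilting right R-module and let X be an object of the unbounded derived category D(R) of Mod-R. If Hom_{D(R)}(T[i], X) = 0 for every integer i, then X ≅ 0 in D(R). -/

import Mathlib

universe w w' w'' v u

open CategoryTheory Limits Pretriangulated

noncomputable section

/-- `M` is a direct summand of a direct sum of copies of `T`. -/
def IsSummandOfCopies {A : Type u} [Ring A] (T M : ModuleCat.{u} A) : Prop :=
  ∃ (α : Type u) (s : M ⟶ ModuleCat.of A (α →₀ T)) (r : ModuleCat.of A (α →₀ T) ⟶ M),
    s ≫ r = 𝟙 M

/-- Condition (T1): `T` admits a projective resolution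
`0 → P_n → ⋯ → P_1 → P_0 → T → 0` of length at most `n`. -/
def HasProjResolutionOfLength {A : Type u} [Ring A] (T : ModuleCat.{u} A) (n : ℕ) : Prop :=
  ∃ P : ProjectiveResolution T, ∀ i : ℕ, n < i → IsZero (P.complex.X i)

/-- Condition (T2): `Ext^i(T, T^(α)) = 0` for all `i > 0` and all index types `α`. -/
def SelfSmallOrthogonal {A : Type u} [Ring A] [HasExt.{w'} (ModuleCat.{u} A)]
    (T : ModuleCat.{u} A) : Prop :=
  ∀ (i : ℕ), 0 < i → ∀ (α : Type u) (x : Abelian.Ext T (ModuleCat.of A (α →₀ T)) i), x = 0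

/-- Condition (T3): there is an exact sequence `0 → A → T_0 → T_1 → ⋯ → T_n → 0`
where each `T_i` is a direct summand of a direct sum of copies of `T`. -/
def HasTiltingCoresolution {A : Type u} [Ring A] (T : ModuleCat.{u} A) (n : ℕ) : Prop :=
  ∃ (C : Fin (n + 2) → ModuleCat.{u} A)
    (d : ∀ i : Fin (n + 1), C i.castSucc ⟶ C i.succ),
    C 0 = ModuleCat.of A A ∧
    (∀ i : Fin (n + 1), IsSummandOfCopies T (C i.succ)) ∧
    Function.Injective (d 0) ∧
    Function.Surjective (d (Fin.last n)) ∧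
    (∀ i : Fin n, Function.Exact (d i.castSucc) (d i.succ))

/-- `T` is an `n`-tilting module. -/
def IsTilting {A : Type u} [Ring A] [HasExt.{w'} (ModuleCat.{u} A)]
    (T : ModuleCat.{u} A) (n : ℕ) : Prop :=
  HasProjResolutionOfLength T n ∧ SelfSmallOrthogonal.{w'} T ∧ HasTiltingCoresolution T n

end

section CochainComplex

variable {C : Type u} [Category.{v} C] [Abelian C] [HasDerivedCategory.{w} C]

open DerivedCategory HomologicalComplex

lemma CochainComplex.IsKProjective.Q_map_eq_zero_iff {K L : CochainComplex C ℤ} [K.IsKProjective]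
    (g : K ⟶ L) : Q.map g = 0 ↔ Nonempty (Homotopy g 0) := by
  refine ⟨fun hg ↦ ⟨HomotopyCategory.homotopyOfEq _ _ ?_⟩, fun ⟨h⟩ ↦ ?_⟩
  · apply (CochainComplex.IsKProjective.Qh_map_bijective K _).injective
    rw [← cancel_mono ((quotientCompQhIso C).hom.app L), quotientCompQhIso_hom_naturality,
      quotientCompQhIso_hom_naturality, hg, Functor.map_zero]
  · rw [DerivedCategory.Q_map_eq_of_homotopy C h, Functor.map_zero]

lemma CochainComplex.IsKProjective.Q_map_surjective (K L : CochainComplex C ℤ) [K.IsKProjective] :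
    Function.Surjective (Q.map : (K ⟶ L) → _) := by
  intro f
  obtain ⟨h, hh⟩ := (CochainComplex.IsKProjective.Qh_map_bijective K _).surjective
    ((quotientCompQhIso C).hom.app K ≫ f ≫ (quotientCompQhIso C).inv.app L)
  obtain ⟨g, rfl⟩ := (HomotopyCategory.quotient C (.up ℤ)).map_surjective h
  refine ⟨g, ?_⟩
  rw [← cancel_epi ((quotientCompQhIso C).hom.app K), ← quotientCompQhIso_hom_naturality, hh]
  simp

lemma DerivedCategory.isZero_of_homologyFunctor {X : DerivedCategory C}
    (h : ∀ n, IsZero ((homologyFunctor C n).obj X)) : IsZero X := by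
  obtain ⟨Z, hZ⟩ := HasZeroObject.zero (C := DerivedCategory C)
  have : IsIso (0 : Z ⟶ X) := by
    rw [isIso_iff]
    intro n
    have h0 := (homologyFunctor C n).map_isZero hZ
    exact ⟨0, h0.eq_of_src _ _, (h n).eq_of_src _ _⟩
  exact hZ.of_iso (asIso (0 : Z ⟶ X)).symm

end CochainComplex

section Module

variable {A : Type u} [Ring A]

open DerivedCategory HomologicalComplex

namespace ModuleCat

/-- The functor sending a module `M` to the direct sum `α →₀ M` of copies of `M`. -/
noncomputable def finsuppFunctor (A : Type u) [Ring A] (α : Type u) :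
    ModuleCat.{u} A ⥤ ModuleCat.{u} A where
  obj M := of A (α →₀ M)
  map f := ofHom (Finsupp.mapRange.linearMap f.hom)

instance (α : Type u) : (finsuppFunctor A α).Additive where
  map_add {M N f g} := by
    refine hom_ext (LinearMap.ext fun (x : α →₀ M) ↦ ?_)
    exact Finsupp.ext fun a ↦ rfl

/-- The inclusion of the summand indexed by `a` as a natural transformation. -/
noncomputable def finsuppInclusion {α : Type u} (a : α) :
    𝟭 (ModuleCat.{u} A) ⟶ finsuppFunctor A α where
  app M := ofHom (Finsupp.lsingle a)
  naturality M N f := by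
    refine hom_ext (LinearMap.ext fun x ↦ ?_)
    exact (Finsupp.mapRange_single (f := f.hom) (hf := map_zero _)).symm

lemma finsuppFunctor_hom_ext {α : Type u} {M N : ModuleCat.{u} A}
    {f g : (finsuppFunctor A α).obj M ⟶ N}
    (h : ∀ a, (finsuppInclusion a).app M ≫ f = (finsuppInclusion a).app M ≫ g) : f = g := by
  apply hom_ext
  refine Finsupp.lhom_ext' fun a ↦ ?_
  exact congrArg Hom.hom (h a)

/-- The morphism from a direct sum of copies of `M` given by a family of morphisms. -/
noncomputable def finsuppDesc {α : Type u} {M N : ModuleCat.{u} A} (f : α → (M ⟶ N)) :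
    (finsuppFunctor A α).obj M ⟶ N :=
  ofHom (Finsupp.lsum ℕ fun a ↦ (f a).hom)

@[simp]
lemma finsuppInclusion_desc {α : Type u} {M N : ModuleCat.{u} A} (f : α → (M ⟶ N)) (a : α) :
    (finsuppInclusion a).app M ≫ finsuppDesc f = f a := by
  refine hom_ext (LinearMap.ext fun x ↦ ?_)
  exact Finsupp.lsum_single ℕ (fun a ↦ (f a).hom) a x

instance (α : Type u) (M : ModuleCat.{u} A) [Projective M] :
    Projective ((finsuppFunctor A α).obj M) where
  factors {E X} f e he := by
    refine ⟨finsuppDesc fun a ↦ Projective.factorThru ((finsuppInclusion a).app M ≫ f) e, ?_⟩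
    refine finsuppFunctor_hom_ext fun a ↦ ?_
    rw [← Category.assoc, finsuppInclusion_desc, Projective.factorThru_comp]

lemma finsuppFunctor_exact (α : Type u) (S : ShortComplex (ModuleCat.{u} A)) (hS : S.Exact) :
    (S.map (finsuppFunctor A α)).Exact := by
  rw [ShortComplex.moduleCat_exact_iff] at hS ⊢
  intro x hx
  have h (a : α) : ∃ y, S.f y = (show α →₀ S.X₂ from x) a :=
    hS _ (DFunLike.congr_fun (show Finsupp.mapRange S.g (map_zero _) x = 0 from hx) a)
  choose y hy using h
  classical
  refine ⟨Finsupp.onFinset (show α →₀ S.X₂ from x).support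
    (fun a ↦ if (show α →₀ S.X₂ from x) a = 0 then 0 else y a)
    (fun a ha ↦ Finsupp.mem_support_iff.2 fun h ↦ ha (if_pos h)), ?_⟩
  refine Finsupp.ext fun a ↦ ?_
  change S.f (if (show α →₀ S.X₂ from x) a = 0 then 0 else y a) = _
  split_ifs with h0
  · rw [map_zero, h0]
  · exact hy a

lemma finsuppFunctor_preserves (α : Type u) :
    PreservesFiniteLimits (finsuppFunctor A α) ∧ PreservesFiniteColimits (finsuppFunctor A α) :=
  ((finsuppFunctor A α).exact_tfae.out 1 3).1 (finsuppFunctor_exact α)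

instance (α : Type u) : PreservesFiniteLimits (finsuppFunctor A α) :=
  (finsuppFunctor_preserves α).1

instance (α : Type u) : PreservesFiniteColimits (finsuppFunctor A α) :=
  (finsuppFunctor_preserves α).2

end ModuleCat

open ModuleCat

/-- The inclusion of the summand indexed by `a` in a direct sum of copies of a complex. -/
noncomputable def CochainComplex.finsuppInclusion (K : CochainComplex (ModuleCat.{u} A) ℤ)
    {α : Type u} (a : α) :
    K ⟶ ((finsuppFunctor A α).mapHomologicalComplex (.up ℤ)).obj K where
  f i := (ModuleCat.finsuppInclusion a).app (K.X i)
  comm' i j _ := ((ModuleCat.finsuppInclusion a).naturality (K.d i j)).symm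

/-- A morphism from a direct sum of copies of a complex is null-homotopic if its restrictions to
all the summands are. -/
noncomputable def CochainComplex.finsuppHomotopy {K L : CochainComplex (ModuleCat.{u} A) ℤ}
    {α : Type u} (g : ((finsuppFunctor A α).mapHomologicalComplex (.up ℤ)).obj K ⟶ L)
    (h : ∀ a, Homotopy (K.finsuppInclusion a ≫ g) 0) : Homotopy g 0 where
  hom i j := show (((finsuppFunctor A α).mapHomologicalComplex (.up ℤ)).obj K).X i ⟶ L.X j from
    finsuppDesc fun a ↦ (h a).hom i j
  zero i j hij := finsuppFunctor_hom_ext fun a ↦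
    (finsuppInclusion_desc _ a).trans (((h a).zero i j hij).trans comp_zero.symm)
  comm i := by
    have hr₁ : (ComplexShape.up ℤ).Rel i (i + 1) := by simp
    have hr₂ : (ComplexShape.up ℤ).Rel (i - 1) i := by simp
    rw [dNext_eq _ hr₁, prevD_eq _ hr₂]
    let G : (finsuppFunctor A α).obj (K.X i) ⟶ L.X i := g.f i
    let D : (finsuppFunctor A α).obj (K.X i) ⟶ L.X i :=
      (finsuppFunctor A α).map (K.d i (i + 1)) ≫ finsuppDesc (fun a ↦ (h a).hom (i + 1) i)
    let E : (finsuppFunctor A α).obj (K.X i) ⟶ L.X i :=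
      finsuppDesc (fun a ↦ (h a).hom i (i - 1)) ≫ L.d (i - 1) i
    change G = D + E + 0
    refine finsuppFunctor_hom_ext fun a ↦ ?_
    have hD : (ModuleCat.finsuppInclusion a).app (K.X i) ≫ D =
        K.d i (i + 1) ≫ (h a).hom (i + 1) i := by
      rw [← NatTrans.naturality_assoc, finsuppInclusion_desc, Functor.id_map]
    have hE : (ModuleCat.finsuppInclusion a).app (K.X i) ≫ E =
        (h a).hom i (i - 1) ≫ L.d (i - 1) i := by
      rw [← Category.assoc, finsuppInclusion_desc]
    have hG := (h a).comm i
    rw [dNext_eq _ hr₁, prevD_eq _ hr₂] at hG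
    rw [add_zero, Preadditive.comp_add, hD, hE]
    exact hG.trans (add_zero _)

variable [HasDerivedCategory.{w} (ModuleCat.{u} A)]

lemma DerivedCategory.hom_single_finsupp_eq_zero {T : ModuleCat.{u} A}
    {Y : DerivedCategory (ModuleCat.{u} A)} (h : ∀ f : (singleFunctor _ 0).obj T ⟶ Y, f = 0)
    {α : Type u} (f : (singleFunctor _ 0).obj ((finsuppFunctor A α).obj T) ⟶ Y) : f = 0 := by
  obtain ⟨L, ⟨e⟩⟩ : ∃ L, Nonempty (Y ≅ Q.obj L) := ⟨_, ⟨(Q.objObjPreimageIso Y).symm⟩⟩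
  let R := ProjectiveResolution.of T
  let K := R.cochainComplex
  let π : K ⟶ (HomologicalComplex.single _ (.up ℤ) 0).obj T := R.π'
  have : QuasiIso π := inferInstanceAs (QuasiIso R.π')
  let F := (finsuppFunctor A α).mapHomologicalComplex (.up ℤ)
  have : CochainComplex.IsStrictlyLE (F.obj K) 0 := by
    rw [CochainComplex.isStrictlyLE_iff]
    exact fun i hi ↦ (finsuppFunctor A α).map_isZero (K.isZero_of_isStrictlyLE 0 i hi)
  have (i : ℤ) : Projective ((F.obj K).X i) :=
    inferInstanceAs (Projective ((finsuppFunctor A α).obj (K.X i)))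
  have := CochainComplex.isKProjective_of_projective (F.obj K) 0
  let p : F.obj K ⟶ (HomologicalComplex.single _ (.up ℤ) 0).obj ((finsuppFunctor A α).obj T) :=
    F.map π ≫ (singleMapHomologicalComplex (finsuppFunctor A α) (.up ℤ) 0).hom.app T
  have : QuasiIso (F.map π) := inferInstance
  have : QuasiIso p := by
    dsimp only [p]
    infer_instance
  have hK (x : Q.obj K ⟶ Q.obj L) : x = 0 := by
    let v := inv (Q.map π)
    have hx : v ≫ x ≫ e.inv = 0 := h (v ≫ x ≫ e.inv)
    exact (Preadditive.IsIso.comp_right_eq_zero x e.inv).1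
      ((Preadditive.IsIso.comp_left_eq_zero v (x ≫ e.inv)).1 hx)
  obtain ⟨g, hg⟩ := CochainComplex.IsKProjective.Q_map_surjective (F.obj K) L
    (Q.map p ≫ f ≫ e.hom)
  have : Q.map g = 0 := (CochainComplex.IsKProjective.Q_map_eq_zero_iff g).2
    ⟨CochainComplex.finsuppHomotopy g fun a ↦
      ((CochainComplex.IsKProjective.Q_map_eq_zero_iff _).1 (hK _)).some⟩
  have h2 : Q.map p ≫ f ≫ e.hom = 0 := by rw [← hg, this]
  exact (Preadditive.IsIso.comp_right_eq_zero f e.hom).1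
    ((Preadditive.IsIso.comp_left_eq_zero (Q.map p) (f ≫ e.hom)).1 h2)

lemma DerivedCategory.prop_single_X₁ (W : ObjectProperty (DerivedCategory (ModuleCat.{u} A)))
    [W.IsClosedUnderIsomorphisms] [W.IsTriangulated] {S : ShortComplex (ModuleCat.{u} A)}
    (hS : S.ShortExact) (h₂ : W ((singleFunctor _ 0).obj S.X₂))
    (h₃ : W ((singleFunctor _ 0).obj S.X₃)) : W ((singleFunctor _ 0).obj S.X₁) :=
  W.ext_of_isTriangulatedClosed₁ _ hS.singleTriangle_distinguished h₂ h₃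

lemma DerivedCategory.prop_single_of_coresolution
    (W : ObjectProperty (DerivedCategory (ModuleCat.{u} A)))
    [W.IsClosedUnderIsomorphisms] [W.IsTriangulated] {n : ℕ} (C : Fin (n + 2) → ModuleCat.{u} A)
    (d : ∀ i : Fin (n + 1), C i.castSucc ⟶ C i.succ)
    (hC : ∀ i : Fin (n + 1), W ((singleFunctor _ 0).obj (C i.succ)))
    (hd₀ : Function.Injective (d 0)) (hd : Function.Surjective (d (Fin.last n)))
    (hd' : ∀ i : Fin n, Function.Exact (d i.castSucc) (d i.succ)) :
    W ((singleFunctor _ 0).obj (C 0)) := by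
  have key (i : Fin (n + 1)) :
      W ((singleFunctor _ 0).obj (ModuleCat.of A (LinearMap.range (d i).hom))) := by
    induction i using Fin.reverseInduction with
    | last =>
      have e := (LinearEquiv.ofTop _ (LinearMap.range_eq_top.2 hd)).toModuleIso
      exact W.prop_of_iso ((singleFunctor _ 0).mapIso e.symm) (hC _)
    | cast i hi =>
      have h := LinearMap.shortExact_shortComplexKer (f := (d i.succ).hom.rangeRestrict)
        (LinearMap.surjective_rangeRestrict _)
      have h₁ := prop_single_X₁ W h (hC i.castSucc) hi
      have e := (LinearEquiv.ofEq (LinearMap.ker (d i.succ).hom.rangeRestrict)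
        (LinearMap.range (d i.castSucc).hom)
        ((LinearMap.ker_rangeRestrict _).trans (hd' i).linearMap_ker_eq)).toModuleIso
      exact W.prop_of_iso ((singleFunctor _ 0).mapIso e) h₁
  have e := (LinearEquiv.ofInjective (d 0).hom hd₀).toModuleIso
  exact W.prop_of_iso ((singleFunctor _ 0).mapIso e.symm) (key 0)

lemma DerivedCategory.isZero_homology_zero {X : DerivedCategory (ModuleCat.{u} A)}
    (h : ∀ f : (singleFunctor _ 0).obj (ModuleCat.of A A) ⟶ X, f = 0) :
    IsZero ((homologyFunctor _ 0).obj X) := by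
  obtain ⟨L, ⟨e⟩⟩ : ∃ L, Nonempty (X ≅ Q.obj L) := ⟨_, ⟨(Q.objObjPreimageIso X).symm⟩⟩
  refine IsZero.of_iso ?_ ((homologyFunctor _ 0).mapIso e ≪≫ (homologyFunctorFactors _ 0).app L)
  let K := (HomologicalComplex.single _ (.up ℤ) 0).obj (ModuleCat.of A A)
  have (i : ℤ) : Projective (K.X i) := by
    by_cases hi : i = 0
    · subst hi
      exact Projective.of_iso (singleObjXSelf (.up ℤ) 0 (ModuleCat.of A A)).symm inferInstance
    · exact (isZero_single_obj_X (.up ℤ) 0 (ModuleCat.of A A) i hi).projective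
  have : CochainComplex.IsStrictlyLE K 0 := by
    rw [CochainComplex.isStrictlyLE_iff]
    exact fun i hi ↦ isZero_single_obj_X _ _ _ _ (by lia)
  have := CochainComplex.isKProjective_of_projective K 0
  have hK (x : Q.obj K ⟶ Q.obj L) : x = 0 :=
    (Preadditive.IsIso.comp_right_eq_zero x e.inv).1 (h (x ≫ e.inv))
  have h₀ : L.ExactAt 0 := by
    rw [L.exactAt_iff' (-1) 0 1 (by simp) (by simp), ShortComplex.moduleCat_exact_iff]
    intro x hx
    let φ : ModuleCat.of A A ⟶ L.X 0 := ModuleCat.ofHom (LinearMap.toSpanSingleton A _ x)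
    have hφ : φ ≫ L.d 0 1 = 0 := by
      refine ModuleCat.hom_ext (LinearMap.ext_ring ?_)
      change L.d 0 1 ((1 : A) • x) = 0
      rw [one_smul]
      exact hx
    let g : K ⟶ L := mkHomFromSingle φ (by
      rintro k rfl
      exact hφ)
    obtain ⟨H⟩ := (CochainComplex.IsKProjective.Q_map_eq_zero_iff g).1 (hK _)
    have hH := H.comm 0
    rw [dNext_eq _ (show (ComplexShape.up ℤ).Rel 0 1 by simp),
      prevD_eq _ (show (ComplexShape.up ℤ).Rel (-1) 0 by simp),
      mkHomFromSingle_f, single_obj_d, zero_comp, zero_add, zero_f, add_zero] at hH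
    let ε := singleObjXSelf (.up ℤ) 0 (ModuleCat.of A A)
    have hφ' : φ = (ε.inv ≫ H.hom 0 (-1)) ≫ L.d (-1) 0 := by
      rw [Category.assoc, ← hH, Iso.inv_hom_id_assoc]
    refine ⟨(ε.inv ≫ H.hom 0 (-1)) (1 : A), ?_⟩
    refine Eq.trans ?_ (one_smul A x)
    exact (ConcreteCategory.congr_hom hφ' (1 : A)).symm
  exact (L.exactAt_iff_isZero_homology 0).1 h₀

lemma DerivedCategory.isZero_of_hom_single_ring_eq_zero {X : DerivedCategory (ModuleCat.{u} A)}
    (h : ∀ (i : ℤ) (f : (singleFunctor _ 0).obj (ModuleCat.of A A) ⟶ X⟦i⟧), f = 0) :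
    IsZero X := by
  refine isZero_of_homologyFunctor fun i ↦ ?_
  exact (isZero_homology_zero (h i)).of_iso
    (((homologyFunctor (ModuleCat.{u} A) 0).shiftIso i 0 i (add_zero i)).app X).symm

end Module
/-- if `T` is an `n`-tilting right `R`-module and `X ∈ D(R)` satisfies
`Hom_{D(R)}(T[i], X) = 0` for all `i : ℤ`, then `X ≅ 0`. -/
theorem tilting_generates_derivedCategory
    (R : Type u) [Ring R]
    [HasExt.{w'} (ModuleCat.{u} Rᵐᵒᵖ)]
    [HasDerivedCategory.{w} (ModuleCat.{u} Rᵐᵒᵖ)]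
    (n : ℕ) (T : ModuleCat.{u} Rᵐᵒᵖ) (hT : IsTilting.{w'} T n)
    (X : DerivedCategory (ModuleCat.{u} Rᵐᵒᵖ))
    (hX : ∀ (i : ℤ)
      (f : ((DerivedCategory.singleFunctor (ModuleCat.{u} Rᵐᵒᵖ) 0).obj T)⟦i⟧ ⟶ X), f = 0) :
    IsZero X := by
  obtain ⟨-, -, C, d, hC₀, hC, hd₀, hd, hd'⟩ := hT
  let W := ((ObjectProperty.singleton X).shiftClosure ℤ).leftOrthogonal
  have hT : W ((DerivedCategory.singleFunctor _ 0).obj T) := by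
    rintro Y f ⟨X, i, e, ⟨⟩⟩
    obtain ⟨g, hg⟩ := ((shiftEquiv _ i).symm.toAdjunction.homEquiv _ _).surjective (f ≫ e.hom)
    rw [Adjunction.homEquiv_unit] at hg
    refine (Preadditive.IsIso.comp_right_eq_zero f e.hom).1 (hg.symm.trans ?_)
    have hg₀ : (shiftFunctor _ i).map g = 0 := by
      rw [hX (-i) g]
      exact (shiftFunctor _ i).map_zero _ _
    exact (congrArg (_ ≫ ·) hg₀).trans comp_zero
  have hW (i : Fin (n + 1)) : W ((DerivedCategory.singleFunctor _ 0).obj (C i.succ)) := by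
    obtain ⟨α, s, r, hsr⟩ := hC i
    intro Y f hY
    have hf := DerivedCategory.hom_single_finsupp_eq_zero (fun f ↦ hT f hY)
      ((DerivedCategory.singleFunctor _ 0).map r ≫ f)
    rw [← Category.id_comp f, ← CategoryTheory.Functor.map_id, ← hsr, Functor.map_comp,
      Category.assoc]
    exact (congrArg (_ ≫ ·) hf).trans comp_zero
  have hA := DerivedCategory.prop_single_of_coresolution W C d hW hd₀ hd hd'
  rw [hC₀] at hA
  exact DerivedCategory.isZero_of_hom_single_ring_eq_zero fun i f ↦ hA f ⟨X, i, .refl _, ⟨()⟩⟩
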